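/- arXiv:2401.15837 — 2 statements merged into one kernel-verified Lean document; each statement's English description precedes it below -/
import Mathlib

section
/- Suppose K is closed at infinity, d = deg f ≥ 1, and there exists x* ∈ K with f(x*) = f_min (a global minimizer). Then sup{γ ∈ ℝ : f̃(x̃) − γ x_0^d ≥ 0 for all (x̃,w) ∈ K̃_s²} = f_min. -/
open MvPolynomial

/-- A sum over overlapping blocks covering the index set, weighted by the inverse multiplicity of
each index, is the plain sum. -/
lemma sum_sum_div_card_filter_mem {n p : ℕ} (I : Fin p → Finset (Fin n))
    (hI : ∀ i, ∃ ℓ, i ∈ I ℓ) (a : Fin n → ℝ) :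
    ∑ ℓ, ∑ i ∈ I ℓ, a i / ((Finset.univ.filter fun ℓ => i ∈ I ℓ).card : ℝ) = ∑ i, a i := by
  have hswap : ∑ ℓ, ∑ i ∈ I ℓ, a i / ((Finset.univ.filter fun ℓ => i ∈ I ℓ).card : ℝ)
      = ∑ i, ∑ ℓ ∈ Finset.univ.filter (fun ℓ => i ∈ I ℓ),
          a i / ((Finset.univ.filter fun ℓ => i ∈ I ℓ).card : ℝ) :=
    Finset.sum_comm' (by simp)
  rw [hswap]
  refine Finset.sum_congr rfl fun i _ => ?_
  obtain ⟨ℓ, hℓ⟩ := hI i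
  have hne : ((Finset.univ.filter fun ℓ => i ∈ I ℓ).card : ℝ) ≠ 0 := by
    exact_mod_cast (Finset.card_pos.2 ⟨ℓ, by simpa using hℓ⟩).ne'
  rw [Finset.sum_const, nsmul_eq_mul]
  field_simp

/-- A homogeneous polynomial evaluated at a rescaled point. -/
lemma MvPolynomial.IsHomogeneous.eval_smul_eq {σ R : Type*} [CommSemiring R]
    {F : MvPolynomial σ R} {d : ℕ} (hF : F.IsHomogeneous d) (t : R) (y : σ → R) :
    eval (t • y) F = t ^ d * eval y F := by
  rw [eval_eq, eval_eq, Finset.mul_sum]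
  refine Finset.sum_congr rfl fun s hs => ?_
  have hdeg : ∑ i ∈ s.support, s i = d := by
    have := hF (mem_support_iff.1 hs)
    simpa [Finsupp.weight_apply, Finsupp.sum] using this
  simp only [Pi.smul_apply, smul_eq_mul, mul_pow, Finset.prod_mul_distrib,
    Finset.prod_pow_eq_pow_sum, hdeg]
  ring

/-- Suppose `K` is closed at infinity, `d = deg f ≥ 1`, and there exists
`x* ∈ K` with `f(x*) = f_min`. Then
`sup {γ : f̃(x̃) − γ x₀^d ≥ 0 on K̃ₛ²} = f_min`. -/
theorem stmt_13
    (n m p : ℕ) (hn : 1 ≤ n) (hm : 1 ≤ m) (hp : 1 ≤ p)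
    (f : MvPolynomial (Fin n) ℝ) (g : Fin m → MvPolynomial (Fin n) ℝ)
    (I : Fin p → Finset (Fin n)) (hI : ∀ i : Fin n, ∃ ℓ : Fin p, i ∈ I ℓ)
    -- p_i: frequency of the variable x_i among the cliques
    (pc : Fin n → ℕ) (hpc : ∀ i, pc i = (Finset.univ.filter fun ℓ => i ∈ I ℓ).card)
    (K : Set (Fin n → ℝ)) (hK : K = {x | ∀ j, 0 ≤ eval x (g j)})
    (d : ℕ) (hd : d = f.totalDegree) (hd1 : 1 ≤ d)
    -- homogenizations
    (F : MvPolynomial (Fin (n + 1)) ℝ)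
    (hFhom : F.IsHomogeneous d)
    (hFdeh : ∀ x : Fin n → ℝ, eval (Fin.cons 1 x) F = eval x f)
    (G : Fin m → MvPolynomial (Fin (n + 1)) ℝ)
    (hGhom : ∀ j, (G j).IsHomogeneous (g j).totalDegree)
    (hGdeh : ∀ j, ∀ x : Fin n → ℝ, eval (Fin.cons 1 x) (G j) = eval x (g j))
    -- K is closed at infinity
    (Kt : Set (Fin (n + 1) → ℝ))
    (hKt : Kt = {y | (∀ j, 0 ≤ eval y (G j)) ∧ 0 ≤ y 0 ∧ ∑ i, (y i) ^ 2 = 1})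
    (hclosed : Kt = closure (Kt ∩ {y | 0 < y 0}))
    -- f_min, attained at a global minimizer x*
    (fmin : ℝ) (xstar : Fin n → ℝ) (hxK : xstar ∈ K)
    (hlow : ∀ x ∈ K, fmin ≤ eval x f) (hattain : eval xstar f = fmin)
    -- the sparse homogenized set K̃ₛ²
    (Ks : Set ((Fin (n + 1) → ℝ) × (Fin p → ℝ)))
    (hKs : Ks = {z | 0 ≤ z.1 0 ∧ (∀ j, 0 ≤ eval z.1 (G j)) ∧
      (∀ ℓ : Fin p, (∑ i ∈ I ℓ, (z.1 i.succ) ^ 2 / (pc i : ℝ))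
        + (z.1 0) ^ 2 / (p : ℝ) + (z.2 ℓ) ^ 2 = 1) ∧
      (∑ ℓ, (z.2 ℓ) ^ 2 = (p : ℝ) - 1) ∧
      (∀ i : Fin (n + 1), 0 ≤ 1 - (z.1 i) ^ 2) ∧
      (∀ ℓ : Fin p, 0 ≤ 1 - (z.2 ℓ) ^ 2)}) :
    sSup {γ : ℝ | ∀ z ∈ Ks, 0 ≤ eval z.1 F - γ * (z.1 0) ^ d} = fmin := by
  subst hKt hKs hK hattain
  obtain rfl : pc = fun i => (Finset.univ.filter fun ℓ => i ∈ I ℓ).card := funext hpc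
  have hp0 : (p : ℝ) ≠ 0 := by positivity
  have hsplit : ∀ y : Fin (n + 1) → ℝ, ∑ i, (y i) ^ 2 = (y 0) ^ 2 + ∑ i : Fin n, (y i.succ) ^ 2 :=
    fun y => Fin.sum_univ_succ _
  have hblocks : ∀ y : Fin (n + 1) → ℝ,
      ∑ ℓ, ((∑ i ∈ I ℓ, (y i.succ) ^ 2 / ((Finset.univ.filter fun ℓ => i ∈ I ℓ).card : ℝ))
        + (y 0) ^ 2 / (p : ℝ)) = ∑ i, (y i) ^ 2 := by
    intro y
    rw [Finset.sum_add_distrib, sum_sum_div_card_filter_mem I hI fun i => (y i.succ) ^ 2, hsplit]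
    simp only [Finset.sum_const, Finset.card_univ, Fintype.card_fin, nsmul_eq_mul]
    field_simp
    ring
  refine IsGreatest.csSup_eq ⟨?_, ?_⟩
  · rintro ⟨y, w⟩ ⟨hy0, hyG, hyw, hw, -, -⟩
    have hsum : ∑ i, (y i) ^ 2 = 1 := by
      have h := Finset.sum_congr (rfl : (Finset.univ : Finset (Fin p)) = _) fun ℓ _ => hyw ℓ
      rw [Finset.sum_add_distrib, hblocks, hw] at h
      simp only [Finset.sum_const, Finset.card_univ, Fintype.card_fin, nsmul_eq_mul] at h
      linarith
    have hmem := hclosed.subset (show y ∈ _ from ⟨hyG, hy0, hsum⟩)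
    have hcl : IsClosed {y : Fin (n + 1) → ℝ | 0 ≤ eval y F - eval xstar f * (y 0) ^ d} := by
      have := MvPolynomial.continuous_eval F
      exact isClosed_le continuous_const (by fun_prop)
    refine closure_minimal ?_ hcl hmem
    rintro u ⟨⟨huG, -, -⟩, hu0⟩
    have hu0 : 0 < u 0 := hu0
    set x : Fin n → ℝ := fun i => u i.succ / u 0 with hx
    have hu : u = u 0 • (Fin.cons 1 x : Fin (n + 1) → ℝ) := by
      funext i
      refine Fin.cases ?_ (fun j => ?_) i
      · simp
      · simp [hx, mul_div_cancel₀ _ hu0.ne']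
    have hxK : ∀ j, 0 ≤ eval x (g j) := by
      intro j
      have h := huG j
      rw [hu, (hGhom j).eval_smul_eq, hGdeh] at h
      exact nonneg_of_mul_nonneg_right h (by positivity)
    have h := hlow x hxK
    have hF : eval u F = u 0 ^ d * eval x f := by
      conv_lhs => rw [hu]
      rw [hFhom.eval_smul_eq, hFdeh]
    show 0 ≤ eval u F - eval xstar f * u 0 ^ d
    rw [hF, mul_comm (eval xstar f), ← mul_sub]
    exact mul_nonneg (by positivity) (sub_nonneg.2 h)
  · intro γ hγ
    have hN : 0 < 1 + ∑ i, (xstar i) ^ 2 := by positivity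
    set t : ℝ := (√(1 + ∑ i, (xstar i) ^ 2))⁻¹ with ht
    have ht0 : 0 < t := by positivity
    set y : Fin (n + 1) → ℝ := t • (Fin.cons 1 xstar : Fin (n + 1) → ℝ) with hy
    have hy0 : y 0 = t := by simp [hy]
    have hsum : ∑ i, (y i) ^ 2 = 1 := by
      rw [hsplit]
      simp only [hy, Pi.smul_apply, Fin.cons_zero, Fin.cons_succ, smul_eq_mul, mul_pow,
        ← Finset.mul_sum, one_pow]
      rw [← mul_add, ht, inv_pow, Real.sq_sqrt hN.le, inv_mul_cancel₀ hN.ne']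
    set s : Fin p → ℝ := fun ℓ =>
      (∑ i ∈ I ℓ, (y i.succ) ^ 2 / ((Finset.univ.filter fun ℓ => i ∈ I ℓ).card : ℝ))
        + (y 0) ^ 2 / (p : ℝ) with hs
    have hs0 : ∀ ℓ, 0 ≤ s ℓ := fun ℓ =>
      add_nonneg (Finset.sum_nonneg fun i _ => div_nonneg (sq_nonneg _) (Nat.cast_nonneg _))
        (div_nonneg (sq_nonneg _) (Nat.cast_nonneg _))
    have hssum : ∑ ℓ, s ℓ = 1 := (hblocks y).trans hsum
    have hs1 : ∀ ℓ, s ℓ ≤ 1 := fun ℓ =>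
      hssum ▸ Finset.single_le_sum (fun ℓ _ => hs0 ℓ) (Finset.mem_univ ℓ)
    have hsq : ∀ ℓ, √(1 - s ℓ) ^ 2 = 1 - s ℓ := fun ℓ => Real.sq_sqrt (sub_nonneg.2 (hs1 ℓ))
    have h := hγ (y, fun ℓ => √(1 - s ℓ)) ⟨ht0.le.trans_eq hy0.symm, fun j => ?_, fun ℓ => ?_, ?_,
      fun i => ?_, fun ℓ => ?_⟩
    · simp only [hy0] at h
      rw [hy, hFhom.eval_smul_eq, hFdeh, mul_comm γ, ← mul_sub] at h
      exact sub_nonneg.1 (nonneg_of_mul_nonneg_right h (by positivity))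
    · show 0 ≤ eval y (G j)
      rw [hy, (hGhom j).eval_smul_eq, hGdeh]
      exact mul_nonneg (by positivity) (hxK j)
    · show s ℓ + √(1 - s ℓ) ^ 2 = 1
      rw [hsq]
      ring
    · simp only [hsq, Finset.sum_sub_distrib, hssum]
      simp
    · exact sub_nonneg.2 (hsum ▸ Finset.single_le_sum (f := fun i => (y i) ^ 2)
        (fun i _ => sq_nonneg _) (Finset.mem_univ i))
    · simp only [hsq]
      linarith [hs0 ℓ]
end

section
/- Let f be a real polynomial in x_1,…,x_n with f(x) > 0 for all x ∈ ℝⁿ and highest-degree homogeneous part f^(∞) positive definite (f^(∞)(x) > 0 for all x ≠ 0). Let x(1),…,x(p) be subsets of {x_1,…,x_n} with union {x_1,…,x_n} and such that f = f_1 + ⋯ + f_p with each f_ℓ using only the variables x(ℓ). Let u(1),…,u(q) be subsets of the variable set {x_0,x_1,…,x_n,w_1,…,w_p} whose union is the whole set, satisfying the RIP, such that f̃ = F_1 + ⋯ + F_q with each F_ℓ ∈ ℝ[u(ℓ)], and such that there is a partition I_1,…,I_q of {1,…,p+1} with h'_j ∈ ℝ[u(ℓ)] whenever j ∈ I_ℓ.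 Then there exist, for each ℓ ∈ {1,…,q}, a sum of squares σ_{ℓ,0} ∈ Σ[u(ℓ)], sums of squares σ_{ℓ,i} ∈ Σ[u(ℓ)] for each variable u_i ∈ u(ℓ), and polynomials τ_{ℓ,j} ∈ ℝ[u(ℓ)] for j ∈ I_ℓ, such that f̃ = Σ_{ℓ=1}^q ( σ_{ℓ,0} + Σ_{u_i ∈ u(ℓ)} σ_{ℓ,i}·(1 − u_i²) + Σ_{j ∈ I_ℓ} τ_{ℓ,j}·h'_j ) as polynomials in x_0,…,x_n,w_1,…,w_p. -/
open MvPolynomial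

/-- `q` is a sum of squares of polynomials using only the variables in `A`. -/
def IsSOSOn {σ : Type*} [DecidableEq σ] (A : Finset σ) (q : MvPolynomial σ ℝ) : Prop :=
  ∃ (t : ℕ) (h : Fin t → MvPolynomial σ ℝ),
    (∀ i, (h i).vars ⊆ A) ∧ q = ∑ i, (h i) ^ 2

open Filter Topology

theorem pow_eq_sum_bernstein {A : Type*} [CommRing A] [Algebra ℝ A] {y z : A} (h : y + z = 1)
    {k a : ℕ} (hak : a ≤ k) :
    y ^ a = ∑ ν ∈ Finset.range (k + 1),
      algebraMap ℝ A ((ν.descFactorial a : ℝ) / k.descFactorial a) *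
        (algebraMap ℝ A (k.choose ν) * (y ^ ν * z ^ (k - ν))) := by
  obtain ⟨b, rfl⟩ := Nat.exists_eq_add_of_le hak
  rw [add_assoc, Finset.sum_range_add, Finset.sum_eq_zero, zero_add]
  · have key : y ^ a = y ^ a * (y + z) ^ b := by simp [h]
    rw [key, add_pow, Finset.mul_sum]
    refine Finset.sum_congr rfl fun m _ => ?_
    have hne : ((a + b).descFactorial a : ℝ) ≠ 0 := by
      exact_mod_cast (Nat.descFactorial_pos.2 (Nat.le_add_right a b)).ne'
    have hc : (((a + m).descFactorial a : ℝ) / (a + b).descFactorial a) * (a + b).choose (a + m)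
        = b.choose m := by
      rw [div_mul_eq_mul_div, div_eq_iff hne]
      have := Nat.choose_mul (n := a + b) (k := a + m) (s := a) (Nat.le_add_right a m)
      simp only [Nat.add_sub_cancel_left] at this
      rw [Nat.descFactorial_eq_factorial_mul_choose, Nat.descFactorial_eq_factorial_mul_choose]
      have h' : (((a + b).choose (a + m) : ℝ) * (a + m).choose a) =
        (a + b).choose a * b.choose m := by exact_mod_cast this
      push_cast
      linear_combination (a.factorial : ℝ) * h'
    rw [← mul_assoc (algebraMap ℝ A _), ← map_mul, hc, Nat.add_sub_add_left, map_natCast, pow_add]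
    ring
  · intro ν hν
    rw [Nat.descFactorial_of_lt (Finset.mem_range.mp hν)]
    simp

theorem tendsto_tsub_div {ν k : ℕ → ℕ} (hk : Tendsto k atTop atTop) {t : ℝ}
    (ht : 0 ≤ t) (h : Tendsto (fun m => (ν m : ℝ) / k m) atTop (𝓝 t)) (a : ℕ) :
    Tendsto (fun m => ((ν m - a : ℕ) : ℝ) / k m) atTop (𝓝 t) := by
  have hk' : Tendsto (fun m => (k m : ℝ)) atTop atTop := tendsto_natCast_atTop_atTop.comp hk
  have h1 : Tendsto (fun m => max ((ν m : ℝ) / k m - (a : ℝ) / k m) 0) atTop (𝓝 (max (t - 0) 0)) :=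
    (h.sub (hk'.const_div_atTop _)).max tendsto_const_nhds
  rw [sub_zero, max_eq_left ht] at h1
  refine h1.congr fun m => ?_
  rw [← sub_div, ← zero_div (k m : ℝ), max_div_div_right (by positivity)]
  congr 1
  rcases le_total a (ν m) with hle | hle
  · rw [Nat.cast_sub hle, max_eq_left]
    simpa using hle
  · rw [Nat.sub_eq_zero_of_le hle, max_eq_right]
    · simp
    · simpa using hle

theorem tendsto_descFactorial_div {ν k : ℕ → ℕ} (hk : Tendsto k atTop atTop) {t : ℝ}
    (ht : 0 ≤ t) (h : Tendsto (fun m => (ν m : ℝ) / k m) atTop (𝓝 t)) (a : ℕ) :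
    Tendsto (fun m => ((ν m).descFactorial a : ℝ) / (k m).descFactorial a) atTop (𝓝 (t ^ a)) := by
  induction a with
  | zero => simp
  | succ a ih =>
    have hpos : ∀ᶠ m in atTop, (k m : ℝ) ≠ 0 := by
      filter_upwards [hk.eventually_gt_atTop 0] with m hm
      positivity
    have hkk : Tendsto (fun m => (k m : ℝ) / k m) atTop (𝓝 1) :=
      tendsto_const_nhds.congr' (hpos.mono fun m hm => (div_self hm).symm)
    have h2 := ((tendsto_tsub_div hk ht h a).div
      (tendsto_tsub_div hk zero_le_one hkk a) one_ne_zero).mul ih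
    rw [div_one, ← pow_succ'] at h2
    refine h2.congr' (hpos.mono fun m hm => ?_)
    simp only [Nat.descFactorial_succ, Pi.div_apply]
    rw [div_div_div_cancel_right₀ hm]
    push_cast
    rw [div_mul_div_comm]

theorem exists_bernsteinCoeff_nonneg {σ : Type*} [Fintype σ] (P : MvPolynomial σ ℝ)
    (hP : ∀ x ∈ Set.univ.pi fun _ : σ => Set.Icc (0 : ℝ) 1, 0 < eval x P) :
    ∃ k, P.totalDegree ≤ k ∧ ∀ ν : σ → ℕ, (∀ i, ν i ≤ k) →
      0 ≤ ∑ α ∈ P.support, coeff α P *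
        ∏ i, ((ν i).descFactorial (α i) : ℝ) / k.descFactorial (α i) := by
  by_contra! hcon
  choose ν hν hneg using fun m : ℕ => hcon (P.totalDegree + m) (Nat.le_add_right _ _)
  obtain ⟨t, ht, φ, hφ, hlim⟩ := (isCompact_univ_pi fun _ : σ => isCompact_Icc).tendsto_subseq
    (x := fun m i => (ν m i : ℝ) / (P.totalDegree + m : ℕ))
    (s := Set.univ.pi fun _ : σ => Set.Icc (0 : ℝ) 1)
    (fun m i _ => ⟨by positivity, div_le_one_of_le₀ (by exact_mod_cast hν m i) (by positivity)⟩)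
  have hk : Tendsto (fun m => P.totalDegree + φ m) atTop atTop :=
    tendsto_atTop_mono (fun m => Nat.le_add_left _ _) hφ.tendsto_atTop
  have hT : Tendsto (fun m => ∑ α ∈ P.support, coeff α P * ∏ i,
      ((ν (φ m) i).descFactorial (α i) : ℝ) / (P.totalDegree + φ m).descFactorial (α i)) atTop
      (𝓝 (∑ α ∈ P.support, coeff α P * ∏ i, t i ^ α i)) :=
    tendsto_finsetSum _ fun α _ => tendsto_const_nhds.mul <| tendsto_finsetProd _ fun i _ =>
      tendsto_descFactorial_div hk (ht i trivial).1 ((tendsto_pi_nhds.1 hlim) i) _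
  rw [← eval_eq'] at hT
  exact absurd (le_of_tendsto' hT fun m => (hneg (φ m)).le) (hP t ht).not_ge

/-- A polynomial positive on the unit box is a nonnegative combination of products of the box
constraints; it therefore lies in any subsemiring containing these. -/
theorem aeval_mem_of_pos_on_unitBox {σ A : Type*} [Fintype σ] [CommRing A] [Algebra ℝ A]
    (T : Subsemiring A) (hT : ∀ c : ℝ, 0 ≤ c → algebraMap ℝ A c ∈ T) (y z : σ → A)
    (hy : ∀ i, y i ∈ T) (hz : ∀ i, z i ∈ T) (hyz : ∀ i, y i + z i = 1) (P : MvPolynomial σ ℝ)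
    (hP : ∀ x ∈ Set.univ.pi fun _ : σ => Set.Icc (0 : ℝ) 1, 0 < eval x P) :
    aeval y P ∈ T := by
  classical
  obtain ⟨k, hk, hpos⟩ := exists_bernsteinCoeff_nonneg P hP
  have key : aeval y P = ∑ ν ∈ Fintype.piFinset fun _ : σ => Finset.range (k + 1),
      algebraMap ℝ A (∑ α ∈ P.support, coeff α P *
        ∏ i, ((ν i).descFactorial (α i) : ℝ) / k.descFactorial (α i)) *
      ∏ i, (algebraMap ℝ A (k.choose (ν i)) * (y i ^ ν i * z i ^ (k - ν i))) := by
    simp_rw [map_sum, Finset.sum_mul]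
    rw [Finset.sum_comm, aeval_def, eval₂_eq']
    refine Finset.sum_congr rfl fun α hα => ?_
    have hdeg : ∀ i, α i ≤ k := fun i =>
      (Finsupp.le_degree i α).trans (by
        have := le_totalDegree hα
        rw [Finsupp.degree_eq_sum]
        rw [Finsupp.sum_fintype _ _ (fun _ => rfl)] at this
        exact this.trans hk)
    simp_rw [fun i => pow_eq_sum_bernstein (hyz i) (hdeg i)]
    rw [Finset.prod_univ_sum, Finset.mul_sum]
    refine Finset.sum_congr rfl fun ν _ => ?_
    rw [Finset.prod_mul_distrib, map_mul, map_prod, mul_assoc]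
  rw [key]
  refine sum_mem fun ν hν => mul_mem (hT _ (hpos ν fun i => ?_)) (prod_mem fun i _ =>
    mul_mem (hT _ (Nat.cast_nonneg _)) (mul_mem (pow_mem (hy i) _) (pow_mem (hz i) _)))
  exact Nat.lt_succ_iff.mp (Finset.mem_range.mp (Fintype.mem_piFinset.mp hν i))

theorem one_sub_mul_pow_le {s : ℝ} (hs : 0 ≤ s) (k : ℕ) : (1 - s) * s ^ k ≤ 1 / (k + 1) := by
  rcases le_total s 1 with h | h
  · rw [le_div_iff₀ (by positivity)]
    have h1 : ((k : ℝ) + 1) * s ^ k ≤ ∑ j ∈ Finset.range (k + 1), s ^ j := by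
      have := Finset.card_nsmul_le_sum (Finset.range (k + 1)) (fun j => s ^ j) (s ^ k)
        fun j hj => pow_le_pow_of_le_one hs h (Nat.lt_succ_iff.mp (Finset.mem_range.mp hj))
      simpa using this
    calc (1 - s) * s ^ k * (k + 1) = (1 - s) * ((k + 1) * s ^ k) := by ring
      _ ≤ (1 - s) * ∑ j ∈ Finset.range (k + 1), s ^ j :=
        mul_le_mul_of_nonneg_left h1 (sub_nonneg.2 h)
      _ = 1 - s ^ (k + 1) := mul_neg_geom_sum s _
      _ ≤ 1 := sub_le_self _ (by positivity)
  · exact (mul_nonpos_of_nonpos_of_nonneg (sub_nonpos.2 h) (by positivity)).trans (by positivity)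

/-- A polynomial positive on `[-1,1]^σ` becomes positive on `[-R,R]^σ` after subtracting a
penalty that lies in the quadratic module of `[-1,1]^σ`. -/
theorem exists_penalty_pos {σ : Type*} [Fintype σ] (G : MvPolynomial σ ℝ)
    (hG : ∀ x ∈ Set.univ.pi fun _ : σ => Set.Icc (-1 : ℝ) 1, 0 < eval x G) (R : ℝ) :
    ∃ k : ℕ, ∀ x ∈ Set.univ.pi fun _ : σ => Set.Icc (-R) R,
      0 < eval x G - ∑ i, (1 - x i ^ 2) * (x i ^ 2) ^ k := by
  classical
  by_contra! hcon
  choose x hx hneg using hcon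
  obtain ⟨t, -, φ, hφ, hlim⟩ :=
    (isCompact_univ_pi fun _ : σ => isCompact_Icc).tendsto_subseq hx
  have hGlim : Tendsto (fun m => eval (x (φ m)) G) atTop (𝓝 (eval t G)) :=
    (G.continuous_eval.tendsto t).comp hlim
  by_cases ht : t ∈ Set.univ.pi fun _ : σ => Set.Icc (-1 : ℝ) 1
  · have hbound : ∀ m, eval (x (φ m)) G ≤ Fintype.card σ * (1 / ((φ m : ℝ) + 1)) := fun m => by
      refine (sub_nonpos.1 (hneg (φ m))).trans ?_
      refine (Finset.sum_le_sum fun i _ => one_sub_mul_pow_le (sq_nonneg _) _).trans ?_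
      simp
    have h0 : Tendsto (fun m => Fintype.card σ * (1 / ((φ m : ℝ) + 1))) atTop
        (𝓝 (Fintype.card σ * 0)) :=
      (tendsto_one_div_add_atTop_nhds_zero_nat.comp hφ.tendsto_atTop).const_mul _
    rw [mul_zero] at h0
    exact (hG t ht).not_ge (le_of_tendsto_of_tendsto' hGlim h0 hbound)
  · obtain ⟨i, hi⟩ : ∃ i, 1 < t i ^ 2 := by
      by_contra! hle
      exact ht fun i _ => abs_le.1 ((sq_le_one_iff_abs_le_one _).1 (hle i))
    set δ := (t i ^ 2 - 1) / 2 with hδ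
    have hδ0 : 0 < δ := by rw [hδ]; linarith
    have hs : ∀ᶠ m in atTop, 1 + δ < x (φ m) i ^ 2 :=
      (((tendsto_pi_nhds.1 hlim) i).pow 2).eventually_const_lt (by rw [hδ]; linarith)
    have hbig : Tendsto (fun m => δ * (1 + φ m * δ)) atTop atTop :=
      (tendsto_atTop_add_const_left _ _ ((tendsto_natCast_atTop_atTop.comp
        hφ.tendsto_atTop).atTop_mul_const hδ0)).const_mul_atTop hδ0
    obtain ⟨m, hm1, hm2, hm3⟩ := (hs.and ((hbig.eventually_gt_atTop
      (Fintype.card σ - (eval t G - 1))).and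
      (hGlim.eventually_const_lt (sub_one_lt (eval t G))))).exists
    have h1 : (1 - x (φ m) i ^ 2) * (x (φ m) i ^ 2) ^ φ m ≤ -(δ * (1 + φ m * δ)) := by
      have hb : 1 + (φ m : ℝ) * δ ≤ (x (φ m) i ^ 2) ^ φ m :=
        (one_add_mul_le_pow (by linarith) _).trans
          (pow_le_pow_left₀ (by linarith) hm1.le _)
      have : δ * (1 + φ m * δ) ≤ (x (φ m) i ^ 2 - 1) * (x (φ m) i ^ 2) ^ φ m :=
        mul_le_mul (by linarith) hb (by positivity) (by linarith)
      linarith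
    have h2 : ∑ j ∈ Finset.univ.erase i, (1 - x (φ m) j ^ 2) * (x (φ m) j ^ 2) ^ φ m
        ≤ (Fintype.card σ : ℝ) := by
      refine (Finset.sum_le_card_nsmul _ _ 1 fun j _ =>
        (one_sub_mul_pow_le (sq_nonneg _) _).trans ?_).trans ?_
      · exact div_le_one_of_le₀ (by simp) (by positivity)
      · rw [nsmul_one]
        exact_mod_cast Finset.card_le_univ _
    have h3 := hneg (φ m)
    rw [← Finset.add_sum_erase _ _ (Finset.mem_univ i)] at h3
    linarith

/-- The preordering generated by a single element of a commutative ring. -/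
def singlePreordering {A : Type*} [CommRing A] (h : A) : Subsemiring A where
  carrier := {p | ∃ a b, IsSumSq a ∧ IsSumSq b ∧ p = a + b * h}
  zero_mem' := ⟨0, 0, .zero, .zero, by ring⟩
  one_mem' := ⟨1, 0, .one, .zero, by ring⟩
  add_mem' := by
    rintro _ _ ⟨a, b, ha, hb, rfl⟩ ⟨c, d, hc, hd, rfl⟩
    exact ⟨a + c, b + d, ha.add hc, hb.add hd, by ring⟩
  mul_mem' := by
    rintro _ _ ⟨a, b, ha, hb, rfl⟩ ⟨c, d, hc, hd, rfl⟩
    exact ⟨a * c + b * d * (h * h), a * d + b * c, (ha.mul hc).add ((hb.mul hd).mul (.mul_self h)),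
      (ha.mul hd).add (hb.mul hc), by ring⟩

theorem isSumSq_algebraMap {A : Type*} [CommRing A] [Algebra ℝ A] {c : ℝ} (hc : 0 ≤ c) :
    IsSumSq (algebraMap ℝ A c) := by
  rw [← Real.mul_self_sqrt hc, map_mul]
  exact .mul_self _

theorem algebraMap_mul_add_mem_singlePreordering {σ : Type*} [Fintype σ] {R : ℝ} (hR : 0 < R)
    {i : σ} {x : MvPolynomial σ ℝ} (hx : x ^ 2 = X i ^ 2) :
    algebraMap ℝ _ (2 * R)⁻¹ * (algebraMap ℝ _ R + x) ∈
      singlePreordering (algebraMap ℝ (MvPolynomial σ ℝ) (R ^ 2) - ∑ j, X j ^ 2) := by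
  classical
  set c := algebraMap ℝ (MvPolynomial σ ℝ) (2 * R)⁻¹ with hc
  set r := algebraMap ℝ (MvPolynomial σ ℝ) R with hr
  refine ⟨c * c * ((r + x) * (r + x) + ∑ j ∈ Finset.univ.erase i, X j ^ 2), c * c,
    (IsSumSq.mul_self _).mul ((IsSumSq.mul_self _).add (.sum_sq _ _)), .mul_self _, ?_⟩
  have h1 : c * (2 * r) = 1 := by
    rw [hc, hr, ← map_ofNat (algebraMap ℝ (MvPolynomial σ ℝ)) 2, ← map_mul, ← map_mul,
      inv_mul_cancel₀ (by positivity), map_one]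
  rw [← Finset.add_sum_erase _ _ (Finset.mem_univ i), map_pow, ← hr, ← hx]
  linear_combination -(c * (r + x)) * h1

/-- Putinar's Positivstellensatz for the cube `[-1,1]^σ`. -/
theorem exists_isSumSq_of_pos_on_cube {σ : Type*} [Fintype σ] (G : MvPolynomial σ ℝ)
    (hG : ∀ x ∈ Set.univ.pi fun _ : σ => Set.Icc (-1 : ℝ) 1, 0 < eval x G) :
    ∃ (s₀ : MvPolynomial σ ℝ) (s : σ → MvPolynomial σ ℝ), IsSumSq s₀ ∧ (∀ i, IsSumSq (s i)) ∧
      G = s₀ + ∑ i, s i * (1 - X i ^ 2) := by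
  set R : ℝ := Fintype.card σ + 1 with hR
  have hR0 : 0 < R := by positivity
  obtain ⟨k, hk⟩ := exists_penalty_pos G hG R
  set g := G - ∑ i, (1 - X i ^ 2) * (X i ^ 2) ^ k with hg
  set y : σ → MvPolynomial σ ℝ := fun i => algebraMap ℝ _ (2 * R)⁻¹ * (algebraMap ℝ _ R + X i)
  have h1 : algebraMap ℝ (MvPolynomial σ ℝ) (2 * R)⁻¹ * (2 * algebraMap ℝ _ R) = 1 := by
    rw [← map_ofNat (algebraMap ℝ (MvPolynomial σ ℝ)) 2, ← map_mul, ← map_mul,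
      inv_mul_cancel₀ (by positivity), map_one]
  set P := aeval (fun i => algebraMap ℝ (MvPolynomial σ ℝ) (2 * R) * X i - algebraMap ℝ _ R) g
  have hyP : aeval y P = g := by
    have : (aeval y).comp (aeval fun i => algebraMap ℝ (MvPolynomial σ ℝ) (2 * R) * X i -
        algebraMap ℝ _ R) = AlgHom.id ℝ (MvPolynomial σ ℝ) := by
      ext1 i
      simp only [AlgHom.comp_apply, aeval_X, map_sub, map_mul, AlgHom.commutes, AlgHom.id_apply, y,
        map_ofNat]
      linear_combination (algebraMap ℝ _ R + X i) * h1
    exact congrArg (fun e => e g) this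
  have hP : ∀ x ∈ Set.univ.pi fun _ : σ => Set.Icc (0 : ℝ) 1, 0 < eval x P := by
    intro x hx
    have hev : eval x P = eval (fun i => 2 * R * x i - R) g := by
      simp only [P, ← aeval_eq_eval, ← AlgHom.comp_apply, comp_aeval]
      congr 2
      ext i
      simp
    rw [hev]
    have := hk (fun i => 2 * R * x i - R) fun i _ => ?_
    · simpa [hg] using this
    · have := (hx i trivial).1
      have := (hx i trivial).2
      constructor <;> nlinarith
  obtain ⟨a, b, ha, hb, hab⟩ := aeval_mem_of_pos_on_unitBox
    (singlePreordering (algebraMap ℝ (MvPolynomial σ ℝ) (R ^ 2) - ∑ j, X j ^ 2))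
    (fun c hc => ⟨_, 0, isSumSq_algebraMap hc, .zero, by ring⟩) y
    (fun i => algebraMap ℝ _ (2 * R)⁻¹ * (algebraMap ℝ _ R + -X i))
    (fun i => algebraMap_mul_add_mem_singlePreordering hR0 rfl)
    (fun i => algebraMap_mul_add_mem_singlePreordering hR0 (neg_sq (X i)))
    (fun i => by simp only [y]; linear_combination h1) P hP
  rw [hyP, hg] at hab
  refine ⟨a + b * algebraMap ℝ _ (R ^ 2 - Fintype.card σ), fun i => b + X i ^ k * X i ^ k,
    ha.add (hb.mul (isSumSq_algebraMap ?_)), fun i => hb.add (.mul_self _), ?_⟩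
  · rw [hR]
    nlinarith [(Nat.cast_nonneg (Fintype.card σ) : (0 : ℝ) ≤ _)]
  · rw [sub_eq_iff_eq_add.1 hab]
    have h2 : ∑ i, (b + X i ^ k * X i ^ k) * (1 - X i ^ 2) =
        b * ((Fintype.card σ : MvPolynomial σ ℝ) - ∑ i, X i ^ 2) +
          ∑ i : σ, (1 - X i ^ 2) * (X i ^ 2 : MvPolynomial σ ℝ) ^ k := by
      have : (Fintype.card σ : MvPolynomial σ ℝ) = ∑ i : σ, 1 := by simp
      rw [this, ← Finset.sum_sub_distrib, Finset.mul_sum, ← Finset.sum_add_distrib]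
      exact Finset.sum_congr rfl fun i _ => by ring
    rw [h2, map_sub, map_natCast]
    ring

theorem exists_mvPolynomial_near {ι : Type*} (f : (ι → Set.Icc (-1 : ℝ) 1) → ℝ)
    (hf : Continuous f) {ε : ℝ} (hε : 0 < ε) :
    ∃ p : MvPolynomial ι ℝ, ∀ y, |eval (fun i => (y i : ℝ)) p - f y| < ε := by
  let c : ι → C(ι → Set.Icc (-1 : ℝ) 1, ℝ) := fun i => ⟨fun y => y i, by fun_prop⟩
  obtain ⟨⟨_, p, rfl⟩, hp⟩ :=
    ContinuousMap.exists_mem_subalgebra_near_continuous_of_separatesPoints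
      (aeval c : MvPolynomial ι ℝ →ₐ[ℝ] _).range (by
        intro y z hyz
        obtain ⟨i, hi⟩ := Function.ne_iff.1 hyz
        exact ⟨c i, ⟨c i, ⟨X i, by simp⟩, rfl⟩, fun h => hi (Subtype.ext h)⟩) f hf ε hε
  refine ⟨p, fun y => ?_⟩
  have hev : eval (fun i => (y i : ℝ)) p = (aeval c p : C(ι → Set.Icc (-1 : ℝ) 1, ℝ)) y := by
    have : (aeval (fun i => (y i : ℝ)) : MvPolynomial ι ℝ →ₐ[ℝ] ℝ) =
        (ContinuousMap.evalAlgHom ℝ ℝ y).comp (aeval c) := by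
      ext i
      simp [c]
    rw [← aeval_eq_eval]
    exact congrArg (fun e => e p) this
  rw [hev]
  exact hp y

theorem eval_congr_of_vars {V : Type*} {g : MvPolynomial V ℝ} {x y : V → ℝ}
    (h : ∀ v ∈ g.vars, x v = y v) : eval x g = eval y g :=
  eval₂Hom_congr' rfl (fun v hv _ => h v hv) rfl

theorem vars_rename_val_subset {V : Type*} [DecidableEq V] {W : Finset V} (p : MvPolynomial W ℝ) :
    (rename Subtype.val p).vars ⊆ W :=
  (vars_rename _ _).trans fun v hv => by
    obtain ⟨w, -, rfl⟩ := Finset.mem_image.1 hv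
    exact w.2

/-- If `A + g` is positive on the cube, a polynomial in the shared variables can be moved from
one summand to the other to make both of them positive. -/
theorem exists_transfer_pos {V : Type*} [Fintype V] [DecidableEq V] (A g : MvPolynomial V ℝ)
    (W : Finset V) (hW : A.vars ∩ g.vars ⊆ W)
    (hpos : ∀ x ∈ Set.univ.pi fun _ : V => Set.Icc (-1 : ℝ) 1, 0 < eval x (A + g)) :
    ∃ P : MvPolynomial V ℝ, P.vars ⊆ W ∧
      (∀ x ∈ Set.univ.pi fun _ : V => Set.Icc (-1 : ℝ) 1, 0 < eval x (A + P)) ∧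
      ∀ x ∈ Set.univ.pi fun _ : V => Set.Icc (-1 : ℝ) 1, 0 < eval x (g - P) := by
  set K := Set.univ.pi fun _ : V => Set.Icc (-1 : ℝ) 1 with hK
  have hKc : IsCompact K := isCompact_univ_pi fun _ => isCompact_Icc
  have hKn : K.Nonempty := ⟨0, fun v _ => by simp⟩
  let F : (V → ℝ) → (V → ℝ) → ℝ := fun x z => eval (fun v => if v ∈ W then x v else z v) g
  have hF : Continuous ↿F := g.continuous_eval.comp <| continuous_pi fun v => by
    by_cases hv : v ∈ W <;> simp only [hv, if_true, if_false] <;> fun_prop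
  have hFx : ∀ x, Continuous (F x) := fun x => hF.comp (by fun_prop : Continuous fun z => (x, z))
  let φ : (V → ℝ) → ℝ := fun x => sInf (F x '' K)
  have hφ : Continuous φ := hKc.continuous_sInf hF
  have hle : ∀ x ∈ K, φ x ≤ eval x g := fun x hx => by
    have : F x x = eval x g := by simp [F]
    rw [← this]
    exact csInf_le (hKc.image (hFx x)).bddBelow ⟨x, hx, rfl⟩
  have hsum : ∀ x ∈ K, 0 < eval x A + φ x := fun x hx => by
    obtain ⟨z, hz, hzx⟩ := (hKc.image (hFx x)).sInf_mem (hKn.image _)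
    let x' : V → ℝ := fun v => if v ∈ W then x v else if v ∈ g.vars then z v else x v
    have hx' : x' ∈ K := fun v _ => by
      simp only [x']
      split_ifs
      exacts [hx v trivial, hz v trivial, hx v trivial]
    have hA : eval x' A = eval x A := eval_congr_of_vars fun v hv => by
      by_cases hvW : v ∈ W
      · simp [x', hvW]
      · have : v ∉ g.vars := fun h => hvW (hW (Finset.mem_inter.2 ⟨hv, h⟩))
        simp [x', this]
    have hg : eval x' g = F x z := eval_congr_of_vars fun v hv => by simp [x', hv]
    have := hpos x' hx'
    rwa [map_add, hA, hg, hzx] at this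
  obtain ⟨x₀, hx₀, hmin⟩ := hKc.exists_isMinOn hKn
    ((A.continuous_eval.add hφ).continuousOn (s := K))
  set ε := eval x₀ A + φ x₀ with hε
  have hε0 : 0 < ε := hsum x₀ hx₀
  let e : (W → Set.Icc (-1 : ℝ) 1) → V → ℝ := fun y v => if h : v ∈ W then y ⟨v, h⟩ else 0
  have he : Continuous e := continuous_pi fun v => by
    by_cases hv : v ∈ W <;> simp only [e, hv, dite_true, dite_false] <;> fun_prop
  obtain ⟨p, hp⟩ := exists_mvPolynomial_near (fun y => φ (e y) - ε / 2)
    ((hφ.comp he).sub continuous_const) (by positivity : 0 < ε / 3)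
  have hclose : ∀ x ∈ K, |eval x (rename Subtype.val p) - (φ x - ε / 2)| < ε / 3 := fun x hx => by
    have hφe : φ (e fun w => ⟨x w, hx w trivial⟩) = φ x := by
      have : F (e fun w => ⟨x w, hx w trivial⟩) = F x := by
        funext z
        simp only [F]
        congr 2
        funext v
        by_cases hv : v ∈ W <;> simp [e, hv]
      simp only [φ, this]
    have := hp fun w => ⟨x w, hx w trivial⟩
    rw [hφe] at this
    rwa [eval_rename]
  refine ⟨rename Subtype.val p, ?_, fun x hx => ?_, fun x hx => ?_⟩
  · exact vars_rename_val_subset p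
  · have h1 : ε ≤ eval x A + φ x := hmin hx
    have h2 := abs_lt.1 (hclose x hx)
    rw [map_add]
    linarith
  · have h1 := hle x hx
    have h2 := abs_lt.1 (hclose x hx)
    rw [map_sub]
    linarith

theorem vars_sum_subset_of_forall {V ι : Type*} [DecidableEq V] {s : Finset ι}
    {g : ι → MvPolynomial V ℝ} {W : Finset V} (h : ∀ i ∈ s, (g i).vars ⊆ W) :
    (∑ i ∈ s, g i).vars ⊆ W :=
  (vars_sum_subset s g).trans (Finset.biUnion_subset.2 h)

/-- Under the running intersection property, a sum of sparse polynomials that is positive on the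
cube can be rewritten as a sum of positive polynomials with the same sparsity. -/
theorem exists_sparse_pos_decomposition {V : Type*} [Fintype V] [DecidableEq V]
    (U : ℕ → Finset V) (q : ℕ)
    (hRIP : ∀ m, m + 1 < q → ∃ s ≤ m, U (m + 1) ∩ (Finset.range (m + 1)).biUnion U ⊆ U s)
    (g : ℕ → MvPolynomial V ℝ) (hg : ∀ ℓ < q, (g ℓ).vars ⊆ U ℓ)
    (hpos : ∀ x ∈ Set.univ.pi fun _ : V => Set.Icc (-1 : ℝ) 1,
      0 < eval x (∑ ℓ ∈ Finset.range q, g ℓ)) :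
    ∃ G : ℕ → MvPolynomial V ℝ, (∀ ℓ < q, (G ℓ).vars ⊆ U ℓ) ∧
      ∑ ℓ ∈ Finset.range q, G ℓ = ∑ ℓ ∈ Finset.range q, g ℓ ∧
      ∀ ℓ < q, ∀ x ∈ Set.univ.pi fun _ : V => Set.Icc (-1 : ℝ) 1, 0 < eval x (G ℓ) := by
  induction q generalizing g with
  | zero => exact ⟨g, hg, rfl, fun ℓ h => absurd h (Nat.not_lt_zero ℓ)⟩
  | succ q ih =>
    rcases q with _ | m
    · refine ⟨g, hg, rfl, fun ℓ hℓ => ?_⟩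
      obtain rfl : ℓ = 0 := by omega
      simpa using hpos
    · obtain ⟨s, hs, hsub⟩ := hRIP m (Nat.lt_succ_self _)
      rw [Finset.sum_range_succ] at hpos
      obtain ⟨P, hPv, hP1, hP2⟩ := exists_transfer_pos (∑ ℓ ∈ Finset.range (m + 1), g ℓ)
        (g (m + 1)) (U (m + 1) ∩ (Finset.range (m + 1)).biUnion U) (by
          rw [Finset.inter_comm]
          refine Finset.inter_subset_inter (hg _ (Nat.lt_succ_self _)) ?_
          exact vars_sum_subset_of_forall fun ℓ hℓ =>
            (hg ℓ ((Finset.mem_range.1 hℓ).trans (Nat.lt_succ_self _))).trans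
              (Finset.subset_biUnion_of_mem U hℓ)) hpos
      have hsum : ∑ ℓ ∈ Finset.range (m + 1), (g ℓ + if ℓ = s then P else 0) =
          ∑ ℓ ∈ Finset.range (m + 1), g ℓ + P := by
        rw [Finset.sum_add_distrib, Finset.sum_ite_eq' _ _ fun _ => P,
          if_pos (Finset.mem_range.2 (Nat.lt_succ_of_le hs))]
      obtain ⟨G, hGv, hGsum, hGpos⟩ := ih (fun k hk => hRIP k (hk.trans (Nat.lt_succ_self _)))
        (fun ℓ => g ℓ + if ℓ = s then P else 0) (fun ℓ hℓ => by
          refine (vars_add_subset _ _).trans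
            (Finset.union_subset (hg ℓ (hℓ.trans (Nat.lt_succ_self _))) ?_)
          split_ifs with h
          · exact h ▸ hPv.trans hsub
          · simp) (fun x hx => by rw [hsum]; exact hP1 x hx)
      refine ⟨fun ℓ => if ℓ = m + 1 then g (m + 1) - P else G ℓ, fun ℓ hℓ => ?_, ?_,
        fun ℓ hℓ => ?_⟩
      · dsimp only
        split_ifs with h
        · subst h
          exact (vars_sub_subset _).trans (Finset.union_subset (hg _ hℓ)
            (hPv.trans Finset.inter_subset_left))
        · exact hGv ℓ (by omega)
      · rw [Finset.sum_range_succ, if_pos rfl, Finset.sum_range_succ _ (m + 1),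
          Finset.sum_congr rfl fun ℓ hℓ => if_neg (Finset.mem_range.1 hℓ).ne, hGsum, hsum]
        ring
      · dsimp only
        split_ifs with h
        · exact hP2
        · exact hGpos ℓ (by omega)

theorem exists_forall_pos_add_mul {X : Type*} [TopologicalSpace X] [FirstCountableTopology X]
    {K : Set X} (hK : IsCompact K) {f h : X → ℝ} (hf : Continuous f) (hh : Continuous h)
    (h0 : ∀ x ∈ K, 0 ≤ h x) (hpos : ∀ x ∈ K, h x = 0 → 0 < f x) :
    ∃ c : ℝ, 0 ≤ c ∧ ∀ x ∈ K, 0 < f x + c * h x := by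
  by_contra! hcon
  choose x hx hle using fun m : ℕ => hcon m m.cast_nonneg
  obtain ⟨t, ht, φ, hφ, hlim⟩ := hK.tendsto_subseq hx
  have hfl := (hf.tendsto t).comp hlim
  have hhl := (hh.tendsto t).comp hlim
  have hφt : Tendsto (fun m => (φ m : ℝ)) atTop atTop :=
    tendsto_natCast_atTop_atTop.comp hφ.tendsto_atTop
  rcases (h0 t ht).eq_or_lt with h | h
  · refine (hpos t ht h.symm).not_ge (le_of_tendsto' hfl fun m => ?_)
    have := hle (φ m)
    have := mul_nonneg (Nat.cast_nonneg (α := ℝ) (φ m)) (h0 _ (hx (φ m)))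
    simp only [Function.comp_apply]
    linarith
  · obtain ⟨m, hm⟩ := ((hfl.add_atTop (hφt.atTop_mul_pos h hhl)).eventually_gt_atTop 0).exists
    exact (hle (φ m)).not_gt hm

theorem IsSumSq.exists_fin_sum_sq {A : Type*} [CommSemiring A] {a : A} (ha : IsSumSq a) :
    ∃ (t : ℕ) (h : Fin t → A), a = ∑ i, h i ^ 2 := by
  induction ha with
  | zero => exact ⟨0, Fin.elim0, by simp⟩
  | sq_add b _ ih =>
    obtain ⟨t, h, rfl⟩ := ih
    exact ⟨t + 1, Fin.cons b h, by simp [Fin.sum_univ_succ, sq]⟩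

theorem IsSumSq.isSOSOn_rename {V : Type*} [DecidableEq V] {W : Finset V} {p : MvPolynomial W ℝ}
    (hp : IsSumSq p) : IsSOSOn W (rename Subtype.val p) := by
  obtain ⟨t, h, rfl⟩ := hp.exists_fin_sum_sq
  exact ⟨t, fun i => rename Subtype.val (h i), fun i => vars_rename_val_subset _, by simp⟩

/-- Putinar's Positivstellensatz for the cube, inside a polynomial subring. -/
theorem exists_isSOSOn_of_pos_on_cube {V : Type*} [DecidableEq V] (W : Finset V)
    (G : MvPolynomial V ℝ) (hGv : G.vars ⊆ W)
    (hG : ∀ x ∈ Set.univ.pi fun _ : V => Set.Icc (-1 : ℝ) 1, 0 < eval x G) :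
    ∃ (s₀ : MvPolynomial V ℝ) (s : V → MvPolynomial V ℝ), IsSOSOn W s₀ ∧
      (∀ v ∈ W, IsSOSOn W (s v)) ∧ G = s₀ + ∑ v ∈ W, s v * (1 - X v ^ 2) := by
  obtain ⟨g, rfl⟩ := exists_rename_eq_of_vars_subset_range G (Subtype.val : W → V)
    Subtype.val_injective (by simpa using hGv)
  obtain ⟨s₀, s, hs₀, hs, hgs⟩ := exists_isSumSq_of_pos_on_cube g fun x hx => by
    have := hG (fun v => if h : v ∈ W then x ⟨v, h⟩ else 0) fun v _ => by
      by_cases h : v ∈ W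
      · simpa [h] using hx ⟨v, h⟩ trivial
      · simp [h]
    rw [eval_rename] at this
    convert this using 3
    funext w
    simp
  refine ⟨rename Subtype.val s₀, fun v => if h : v ∈ W then rename Subtype.val (s ⟨v, h⟩) else 0,
    hs₀.isSOSOn_rename, fun v hv => ?_, ?_⟩
  · simpa [hv] using (hs ⟨v, hv⟩).isSOSOn_rename
  · conv_lhs => rw [hgs]
    rw [map_add, map_sum, ← Finset.sum_coe_sort W]
    simp

/-- The sparse Positivstellensatz for the cube, with additional equality constraints. -/
theorem exists_sparse_representation {V : Type*} [Fintype V] [DecidableEq V] {q r : ℕ}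
    (U : Fin q → Finset V)
    (hRIP : ∀ (ℓ : Fin q) (h : (ℓ : ℕ) + 1 < q), ∃ s : Fin q, s ≤ ℓ ∧
      U ⟨(ℓ : ℕ) + 1, h⟩ ∩ (Finset.Iic ℓ).biUnion U ⊆ U s)
    (f : Fin q → MvPolynomial V ℝ) (hf : ∀ ℓ, (f ℓ).vars ⊆ U ℓ)
    (H : Fin r → MvPolynomial V ℝ) (c : Fin r → Fin q) (hH : ∀ j, (H j).vars ⊆ U (c j))
    (hpos : ∀ x ∈ Set.univ.pi fun _ : V => Set.Icc (-1 : ℝ) 1, (∀ j, eval x (H j) = 0) →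
      0 < eval x (∑ ℓ, f ℓ)) :
    ∃ (s₀ : Fin q → MvPolynomial V ℝ) (s : Fin q → V → MvPolynomial V ℝ)
      (τ : Fin r → MvPolynomial V ℝ),
      (∀ ℓ, IsSOSOn (U ℓ) (s₀ ℓ)) ∧ (∀ ℓ, ∀ v ∈ U ℓ, IsSOSOn (U ℓ) (s ℓ v)) ∧
      (∀ j, (τ j).vars ⊆ U (c j)) ∧
      ∑ ℓ, f ℓ = (∑ ℓ, (s₀ ℓ + ∑ v ∈ U ℓ, s ℓ v * (1 - X v ^ 2))) + ∑ j, τ j * H j := by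
  obtain ⟨a, -, ha⟩ := exists_forall_pos_add_mul
    (isCompact_univ_pi fun _ : V => isCompact_Icc (a := (-1 : ℝ)) (b := 1))
    (∑ ℓ, f ℓ).continuous_eval (∑ j, H j ^ 2).continuous_eval
    (fun x _ => by
      rw [map_sum]
      exact Finset.sum_nonneg fun j _ => by rw [map_pow]; positivity)
    (fun x hx h0 => hpos x hx fun j => by
      simp only [map_sum, map_pow] at h0
      exact pow_eq_zero_iff two_ne_zero |>.1
        ((Finset.sum_eq_zero_iff_of_nonneg fun j _ => sq_nonneg _).1 h0 j (Finset.mem_univ j)))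
  let g : Fin q → MvPolynomial V ℝ := fun ℓ =>
    f ℓ + ∑ j with c j = ℓ, C a * H j * H j
  have hgv : ∀ ℓ, (g ℓ).vars ⊆ U ℓ := fun ℓ => by
    refine (vars_add_subset _ _).trans (Finset.union_subset (hf ℓ)
      (vars_sum_subset_of_forall fun j hj => ?_))
    have hj' : (H j).vars ⊆ U ℓ := (Finset.mem_filter.1 hj).2 ▸ hH j
    refine (vars_mul _ _).trans (Finset.union_subset ((vars_mul _ _).trans
      (Finset.union_subset ?_ hj')) hj')
    simp
  have hgsum : ∑ ℓ, g ℓ = ∑ ℓ, f ℓ + ∑ j, C a * H j * H j := by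
    rw [Finset.sum_add_distrib, Finset.sum_fiberwise]
  let U' : ℕ → Finset V := fun ℓ => if h : ℓ < q then U ⟨ℓ, h⟩ else ∅
  have hU' : ∀ ℓ : Fin q, U' ℓ = U ℓ := fun ℓ => by simp [U']
  let g' : ℕ → MvPolynomial V ℝ := fun ℓ => if h : ℓ < q then g ⟨ℓ, h⟩ else 0
  have hg' : ∑ ℓ ∈ Finset.range q, g' ℓ = ∑ ℓ, g ℓ := by
    rw [Finset.sum_range]
    simp [g']
  obtain ⟨G, hGv, hGsum, hGpos⟩ := exists_sparse_pos_decomposition U' q (fun m hm => by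
      obtain ⟨s, hs, hsub⟩ := hRIP ⟨m, (Nat.lt_succ_self m).trans hm⟩ hm
      refine ⟨s, hs, ?_⟩
      rw [hU', hU' ⟨m + 1, hm⟩]
      refine (Finset.inter_subset_inter_left fun v hv => ?_).trans hsub
      obtain ⟨k, hk, hvk⟩ := Finset.mem_biUnion.1 hv
      have hkm := Nat.lt_succ_iff.1 (Finset.mem_range.1 hk)
      have hkq : k < q := hkm.trans_lt ((Nat.lt_succ_self m).trans hm)
      rw [hU' ⟨k, hkq⟩] at hvk
      exact Finset.mem_biUnion.2 ⟨⟨k, hkq⟩, Finset.mem_Iic.2 hkm, hvk⟩)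
    g' (fun ℓ hℓ => by simpa [g', U', hℓ] using hgv ⟨ℓ, hℓ⟩) (fun x hx => by
      rw [hg', hgsum]
      convert ha x hx using 1
      simp only [map_add, map_sum, map_mul, eval_C, map_pow, Finset.mul_sum]
      congr 1
      exact Finset.sum_congr rfl fun j _ => by ring)
  choose s₀ s hs₀ hs hGs using fun ℓ : Fin q =>
    exists_isSOSOn_of_pos_on_cube (U ℓ) (G ℓ) (hU' ℓ ▸ hGv ℓ ℓ.2) (hGpos ℓ ℓ.2)
  refine ⟨s₀, s, fun j => C (-a) * H j, hs₀, hs, fun j => ?_, ?_⟩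
  · refine (vars_mul _ _).trans (Finset.union_subset ?_ (hH j))
    simp
  · rw [Finset.sum_congr rfl fun ℓ _ => (hGs ℓ).symm, ← Finset.sum_range fun ℓ => G ℓ, hGsum, hg',
      hgsum, add_assoc, ← Finset.sum_add_distrib,
      Finset.sum_eq_zero (s := (Finset.univ : Finset (Fin r))), add_zero]
    intro j _
    rw [C_neg]
    ring

theorem MvPolynomial.IsHomogeneous.eval_const_mul {ι : Type*} [Fintype ι] {F : MvPolynomial ι ℝ}
    {d : ℕ} (hF : F.IsHomogeneous d) (c : ℝ) (x : ι → ℝ) :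
    eval (fun i => c * x i) F = c ^ d * eval x F := by
  rw [eval_eq', eval_eq', Finset.mul_sum]
  refine Finset.sum_congr rfl fun α hα => ?_
  have hd : ∑ i, α i = d := by
    rw [← Finsupp.degree_eq_sum, Finsupp.degree_eq_weight_one]
    exact hF (mem_support_iff.1 hα)
  simp_rw [mul_pow]
  rw [Finset.prod_mul_distrib, Finset.prod_pow_eq_pow_sum, hd]
  ring

/-- The homogenization of a positive polynomial with positive definite leading form is positive
definite. -/
theorem eval_homogenization_pos {n d : ℕ} (hn : 1 ≤ n) {F : MvPolynomial (Fin (n + 1)) ℝ}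
    (hF : F.IsHomogeneous d) (hF1 : ∀ x : Fin n → ℝ, 0 < eval (Fin.cons 1 x) F)
    (hF0 : ∀ x : Fin n → ℝ, x ≠ 0 → 0 < eval (Fin.cons 0 x) F) {y : Fin (n + 1) → ℝ}
    (hy : y ≠ 0) : 0 < eval y F := by
  have hd : Even d := by
    by_contra hodd
    have hne : (fun _ : Fin n => (1 : ℝ)) ≠ 0 := fun h => one_ne_zero (congrFun h ⟨0, hn⟩)
    have hneg := hF0 _ (neg_ne_zero.2 hne)
    have h1 : (Fin.cons 0 (-fun _ : Fin n => (1 : ℝ)) : Fin (n + 1) → ℝ) =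
        fun i => -1 * (Fin.cons 0 (fun _ : Fin n => (1 : ℝ)) : Fin (n + 1) → ℝ) i := by
      funext i
      refine Fin.cases ?_ (fun i => ?_) i <;> simp
    rw [h1, hF.eval_const_mul, (Nat.not_even_iff_odd.1 hodd).neg_one_pow] at hneg
    linarith [hF0 _ hne]
  rcases eq_or_ne (y 0) 0 with h | h
  · have hyt : (Fin.cons 0 (Fin.tail y) : Fin (n + 1) → ℝ) = y := by
      rw [← h, Fin.cons_self_tail]
    rw [← hyt]
    refine hF0 _ fun h0 => hy ?_
    rw [← hyt, h0]
    funext i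
    refine Fin.cases ?_ (fun i => ?_) i <;> simp
  · have hyt : y = fun i => y 0 * (Fin.cons 1 fun i => y i.succ / y 0 : Fin (n + 1) → ℝ) i := by
      funext i
      refine Fin.cases ?_ (fun i => ?_) i
      · simp
      · simp [mul_div_cancel₀ _ h]
    rw [hyt, hF.eval_const_mul]
    exact mul_pos (hd.pow_pos h) (hF1 _)

/-- Let `f > 0` on `ℝⁿ` with `f^(∞)` positive definite, with csp
`(x(1),…,x(p))`, and let `u(1),…,u(q)` be cliques of the lifted variables
`{x₀,…,x_n,w_1,…,w_p}` covering all of them, satisfying the RIP, decomposing `f̃`,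
and supporting the constraint polynomials `h'_1,…,h'_{p+1}` (partitioned via
`iCl : Fin (p+1) → Fin q`). Then `f̃` has a sparse representation
`f̃ = Σ_ℓ (σ_{ℓ,0} + Σ_{u_i∈u(ℓ)} σ_{ℓ,i}·(1 − u_i²)) + Σ_j τ_j·h'_j`
with all `σ`'s sums of squares in `ℝ[u(ℓ)]` and `τ_j ∈ ℝ[u(iCl j)]`. -/
theorem stmt_16
    (n p q : ℕ) (hn : 1 ≤ n) (hp : 1 ≤ p) (hq : 1 ≤ q)
    (f : MvPolynomial (Fin n) ℝ)
    (hfpos : ∀ x : Fin n → ℝ, 0 < eval x f)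
    -- homogenization of f
    (F : MvPolynomial (Fin (n + 1)) ℝ)
    (hFhom : F.IsHomogeneous f.totalDegree)
    (hFdeh : ∀ x : Fin n → ℝ, eval (Fin.cons 1 x) F = eval x f)
    -- the highest-degree homogeneous part f^(∞)(x) = f̃(0,x) is positive definite
    (hFinf : ∀ x : Fin n → ℝ, x ≠ 0 → 0 < eval (Fin.cons 0 x) F)
    -- correlative sparsity pattern of f
    (I : Fin p → Finset (Fin n)) (hI : ∀ i : Fin n, ∃ ℓ : Fin p, i ∈ I ℓ)
    (fdec : Fin p → MvPolynomial (Fin n) ℝ)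
    (hfdec : f = ∑ ℓ, fdec ℓ) (hfvars : ∀ ℓ, (fdec ℓ).vars ⊆ I ℓ)
    -- p_i: frequency of the variable x_i among the cliques
    (pc : Fin n → ℕ) (hpc : ∀ i, pc i = (Finset.univ.filter fun ℓ => i ∈ I ℓ).card)
    -- the constraint polynomials h'_1,…,h'_p, h'_{p+1}
    (H : Fin (p + 1) → MvPolynomial (Fin (n + 1) ⊕ Fin p) ℝ)
    (hH : ∀ ℓ : Fin p, H ℓ.castSucc =
      (∑ i ∈ I ℓ, C ((pc i : ℝ))⁻¹ * (X (Sum.inl i.succ)) ^ 2)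
        + C ((p : ℝ))⁻¹ * (X (Sum.inl 0)) ^ 2 + (X (Sum.inr ℓ)) ^ 2 - 1)
    (hHlast : H (Fin.last p) = (∑ ℓ, (X (Sum.inr ℓ)) ^ 2) - C ((p : ℝ) - 1))
    -- the cliques u(1),…,u(q) of the lifted variables
    (U : Fin q → Finset (Fin (n + 1) ⊕ Fin p))
    (hU : ∀ v : Fin (n + 1) ⊕ Fin p, ∃ ℓ : Fin q, v ∈ U ℓ)
    -- running intersection property for the u-cliques
    (hRIP : ∀ (ℓ : Fin q) (h : (ℓ : ℕ) + 1 < q), ∃ s : Fin q, s ≤ ℓ ∧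
      U ⟨(ℓ : ℕ) + 1, h⟩ ∩ (Finset.Iic ℓ).biUnion U ⊆ U s)
    -- f̃ decomposes along the u-cliques
    (Fdec : Fin q → MvPolynomial (Fin (n + 1) ⊕ Fin p) ℝ)
    (hFdec : rename Sum.inl F = ∑ ℓ, Fdec ℓ)
    (hFdecvars : ∀ ℓ, (Fdec ℓ).vars ⊆ U ℓ)
    -- the constraints h'_j are supported on the u-cliques (partition I_1,…,I_q)
    (iCl : Fin (p + 1) → Fin q)
    (hHvars : ∀ j, (H j).vars ⊆ U (iCl j)) :
    ∃ (σ0 : Fin q → MvPolynomial (Fin (n + 1) ⊕ Fin p) ℝ)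
      (σu : Fin q → (Fin (n + 1) ⊕ Fin p) → MvPolynomial (Fin (n + 1) ⊕ Fin p) ℝ)
      (τ : Fin (p + 1) → MvPolynomial (Fin (n + 1) ⊕ Fin p) ℝ),
      (∀ ℓ, IsSOSOn (U ℓ) (σ0 ℓ)) ∧
      (∀ ℓ, ∀ v ∈ U ℓ, IsSOSOn (U ℓ) (σu ℓ v)) ∧
      (∀ j, (τ j).vars ⊆ U (iCl j)) ∧
      rename Sum.inl F
        = (∑ ℓ, (σ0 ℓ + ∑ v ∈ U ℓ, σu ℓ v * (1 - (X v) ^ 2)))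
          + ∑ j, τ j * H j := by
  rw [hFdec]
  refine exists_sparse_representation U hRIP Fdec hFdecvars H iCl hHvars fun z _ hz => ?_
  rw [← hFdec, eval_rename]
  refine eval_homogenization_pos hn hFhom (fun x => hFdeh x ▸ hfpos x) hFinf fun h0 => ?_
  have hz0 : ∀ i, z (Sum.inl i) = 0 := congrFun h0
  have hw : ∀ ℓ, z (Sum.inr ℓ) ^ 2 = 1 := fun ℓ => by
    have := hz ℓ.castSucc
    rw [hH] at this
    simp [hz0] at this
    linarith
  have hlast := hz (Fin.last p)
  rw [hHlast] at hlast
  simp [hw] at hlast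
end
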